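/- arXiv:1309.5603 — 3 statements merged into one kernel-verified Lean document; each statement's English description precedes it below -/
import Mathlib

section
/- Fixed Proportion Decomposition, irrational case: Fix L > 0 and p ∈ (0,1), and suppose y = log₁₀((1−p)/p) is irrational. Then for every s ∈ [1,10), lim_{N→∞} Σ_{k=0}^{N} 2^{−N} · C(N,k) · φ_s(L·p^{N−k}·(1−p)^k) = log₁₀ s, where C(N,k) is the binomial coefficient. That is, the stick lengths produced after N stages of cutting every piece at the fixed proportion p (so the length L·p^{N−k}(1−p)^k occurs with multiplicity C(N,k) among the 2^N pieces) converge in distribution to Benford's Law. -/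
open Filter

/-- Base-10 significand: for `x > 0`, `x = signif x * 10 ^ k` with `signif x ∈ [1,10)`. -/
noncomputable def signif (x : ℝ) : ℝ := x / (10 : ℝ) ^ (⌊Real.logb 10 x⌋)

/-- `phi s x = 1` if the significand of `x` is at most `s`, else `0`. -/
noncomputable def phi (s x : ℝ) : ℝ := if signif x ≤ s then 1 else 0

/-- The proportion of the `2^N` pieces of the fixed-proportion decomposition whose
significand is at most `s`: length `L p^{N-k} (1-p)^k` occurs with multiplicity `C(N,k)`. -/
noncomputable def fixedP (L p : ℝ) (N : ℕ) (s : ℝ) : ℝ :=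
  ∑ k ∈ Finset.range (N + 1),
    (1 / 2 ^ N : ℝ) * (N.choose k : ℝ) * phi s (L * p ^ (N - k) * (1 - p) ^ k)

open MeasureTheory Topology

/-- Probability measures on the circle converge weakly as soon as their Fourier coefficients
converge. -/
theorem AddCircle.tendsto_probabilityMeasure_of_fourier {T : ℝ} [Fact (0 < T)] {ι : Type*}
    {l : Filter ι} {μ : ι → ProbabilityMeasure (AddCircle T)} {μ₀ : ProbabilityMeasure (AddCircle T)}
    (h : ∀ n : ℤ, Tendsto (fun i => ∫ x, fourier n x ∂(μ i : Measure (AddCircle T))) l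
      (𝓝 (∫ x, fourier n x ∂(μ₀ : Measure (AddCircle T))))) :
    Tendsto μ l (𝓝 μ₀) := by
  have hint (ν : ProbabilityMeasure (AddCircle T)) (f : C(AddCircle T, ℂ)) :
      Integrable f (ν : Measure (AddCircle T)) :=
    (BoundedContinuousFunction.mkOfCompact f).integrable _
  have hlip (ν : ProbabilityMeasure (AddCircle T)) :
      LipschitzWith 1 fun f : C(AddCircle T, ℂ) => ∫ x, f x ∂(ν : Measure (AddCircle T)) := by
    refine LipschitzWith.of_dist_le_mul fun f g => ?_
    rw [dist_eq_norm, dist_eq_norm, ← integral_sub (hint ν f) (hint ν g)]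
    simpa using norm_integral_le_of_norm_le_const (μ := (ν : Measure (AddCircle T)))
      (Eventually.of_forall fun x => (f - g).norm_coe_le_norm x)
  have hclosed : IsClosed {f : C(AddCircle T, ℂ) | Tendsto
      (fun i => ∫ x, f x ∂(μ i : Measure (AddCircle T))) l
      (𝓝 (∫ x, f x ∂(μ₀ : Measure (AddCircle T))))} :=
    (LipschitzWith.uniformEquicontinuous _ 1 fun i => hlip (μ i)).equicontinuous
      |>.isClosed_setOfPred_tendsto (hlip μ₀).continuous
  have hspan : (Submodule.span ℂ (Set.range (@fourier T)) : Set C(AddCircle T, ℂ)) ⊆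
      {f : C(AddCircle T, ℂ) | Tendsto (fun i => ∫ x, f x ∂(μ i : Measure (AddCircle T))) l
        (𝓝 (∫ x, f x ∂(μ₀ : Measure (AddCircle T))))} := by
    intro f hf
    induction hf using Submodule.span_induction with
    | mem f hf => obtain ⟨n, rfl⟩ := hf; exact h n
    | zero => simpa using tendsto_const_nhds
    | add f g _ _ hf hg =>
      simpa [integral_add (hint _ f) (hint _ g)] using Tendsto.add hf hg
    | smul c f _ hf =>
      simpa [integral_const_mul] using Tendsto.const_mul c hf
  rw [ProbabilityMeasure.tendsto_iff_forall_integral_rclike_tendsto ℂ]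
  intro f
  refine closure_minimal hspan hclosed (a := f.toContinuousMap) ?_
  rw [← Submodule.topologicalClosure_coe, span_fourier_closure_eq_top]
  trivial

theorem UnitAddCircle.integral_fourier {n : ℤ} (hn : n ≠ 0) :
    ∫ x : UnitAddCircle, fourier n x = 0 := by
  have h := congrFun (fourierCoeff_fourier (T := 1) n) 0
  rw [fourierCoeff, AddCircle.integral_haarAddCircle] at h
  simpa [hn.symm] using h

/-- **Weyl's criterion** for weighted averages over finite families of points. -/
theorem UnitAddCircle.tendsto_sum_indicator_of_fourier {κ : ℕ → Finset ℕ} {w : ℕ → ℕ → ℝ}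
    {x : ℕ → ℕ → UnitAddCircle} (hw : ∀ N, ∀ k ∈ κ N, 0 ≤ w N k) (hw1 : ∀ N, ∑ k ∈ κ N, w N k = 1)
    (h : ∀ n : ℤ, n ≠ 0 →
      Tendsto (fun N => ∑ k ∈ κ N, (w N k : ℂ) * fourier n (x N k)) atTop (𝓝 0))
    {A : Set UnitAddCircle} (hAm : MeasurableSet A) (hA : volume (frontier A) = 0) :
    Tendsto (fun N => ∑ k ∈ κ N, w N k * A.indicator 1 (x N k)) atTop
      (𝓝 (volume.real A)) := by
  let ν : ℕ → Measure UnitAddCircle := fun N =>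
    ∑ k ∈ κ N, ENNReal.ofReal (w N k) • Measure.dirac (x N k)
  have hν (N : ℕ) : IsProbabilityMeasure (ν N) := by
    constructor
    simp only [ν, Measure.coe_finsetSum, Finset.sum_apply, Measure.smul_apply, measure_univ,
      smul_eq_mul, mul_one]
    rw [← ENNReal.ofReal_sum_of_nonneg (hw N), hw1, ENNReal.ofReal_one]
  have hvol : IsProbabilityMeasure (volume : Measure UnitAddCircle) := ⟨UnitAddCircle.measure_univ⟩
  have hlim : Tendsto (β := ProbabilityMeasure UnitAddCircle) (fun N => ⟨ν N, hν N⟩) atTop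
      (𝓝 ⟨volume, hvol⟩) := by
    refine AddCircle.tendsto_probabilityMeasure_of_fourier fun n => ?_
    rcases eq_or_ne n 0 with rfl | hn
    · simp
    · simp only [ProbabilityMeasure.coe_mk, integral_fourier hn]
      refine (h n hn).congr fun N => ?_
      rw [integral_finsetSum_measure]
      · refine Finset.sum_congr rfl fun k hk => ?_
        rw [integral_smul_measure, integral_dirac, ENNReal.toReal_ofReal (hw N k hk),
          Complex.real_smul]
      · intro k _
        exact (BoundedContinuousFunction.mkOfCompact (fourier n)).integrable _ |>.smul_measure
          ENNReal.ofReal_ne_top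
  have hmeas := (ENNReal.tendsto_toReal (measure_ne_top volume A)).comp
    (ProbabilityMeasure.tendsto_measure_of_null_frontier_of_tendsto' hlim hA)
  refine hmeas.congr fun N => ?_
  simp only [Function.comp_apply, ProbabilityMeasure.coe_mk, ν, Measure.coe_finsetSum,
    Finset.sum_apply, Measure.smul_apply, smul_eq_mul, Measure.dirac_apply' _ hAm]
  rw [ENNReal.toReal_sum]
  · refine Finset.sum_congr rfl fun k hk => ?_
    by_cases hx : x N k ∈ A <;> simp [hx, hw N k hk]
  · intro k _
    by_cases hx : x N k ∈ A <;> simp [hx]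

theorem UnitAddCircle.volume_frontier_image_Icc (a b : ℝ) :
    volume (frontier ((↑) '' Set.Icc a b : Set UnitAddCircle)) = 0 := by
  have hsing (x : UnitAddCircle) : volume {x} = 0 := by
    rw [← Metric.closedBall_zero, AddCircle.volume_closedBall]
    simp
  refine measure_mono_null (t := {(a : UnitAddCircle)} ∪ {(b : UnitAddCircle)}) ?_
    (measure_union_null (hsing _) (hsing _))
  have hclosed : IsClosed ((↑) '' Set.Icc a b : Set UnitAddCircle) :=
    (isCompact_Icc.image (AddCircle.continuous_mk' 1)).isClosed
  have hopen : IsOpen ((↑) '' Set.Ioo a b : Set UnitAddCircle) :=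
    QuotientAddGroup.isOpenMap_coe _ isOpen_Ioo
  rintro _ hx
  rw [hclosed.frontier_eq] at hx
  obtain ⟨⟨y, hy, rfl⟩, hx⟩ := hx
  have hy' : y ∉ Set.Ioo a b := fun hy' =>
    hx (interior_maximal (Set.image_mono Set.Ioo_subset_Icc_self) hopen ⟨y, hy', rfl⟩)
  rcases hy.1.eq_or_lt with rfl | hay
  · simp
  rcases hy.2.eq_or_lt with rfl | hyb
  · simp
  exact absurd ⟨hay, hyb⟩ hy'

theorem UnitAddCircle.coe_mem_image_Icc_iff {t : ℝ} (ht : t < 1) (u : ℝ) :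
    (u : UnitAddCircle) ∈ ((↑) '' Set.Icc 0 t : Set UnitAddCircle) ↔ Int.fract u ≤ t := by
  constructor
  · rintro ⟨y, hy, hyu⟩
    obtain ⟨n, hn⟩ := AddCircle.coe_eq_zero_iff (1 : ℝ) |>.1
      (show ((u - y : ℝ) : UnitAddCircle) = 0 by rw [AddCircle.coe_sub, hyu, sub_self])
    have hfract : Int.fract u = y :=
      Int.fract_eq_iff.2 ⟨hy.1, hy.2.trans_lt ht, n, by simpa using hn.symm⟩
    exact hfract.trans_le hy.2
  · intro h
    refine ⟨Int.fract u, ⟨Int.fract_nonneg u, h⟩, ?_⟩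
    rw [← sub_eq_zero, ← AddCircle.coe_sub, AddCircle.coe_eq_zero_iff]
    exact ⟨-⌊u⌋, by rw [← Int.self_sub_floor]; simp⟩

theorem UnitAddCircle.volume_real_image_Icc {t : ℝ} (ht0 : 0 ≤ t) (ht : t < 1) :
    volume.real ((↑) '' Set.Icc 0 t : Set UnitAddCircle) = t := by
  have hclosed : IsClosed ((↑) '' Set.Icc 0 t : Set UnitAddCircle) :=
    (isCompact_Icc.image (AddCircle.continuous_mk' 1)).isClosed
  have hset : ((↑) : ℝ → UnitAddCircle) ⁻¹' ((↑) '' Set.Icc 0 t) ∩ Set.Ioc (t - 1) (t - 1 + 1) =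
      Set.Icc 0 t := by
    ext u
    simp only [Set.mem_inter_iff, Set.mem_preimage, coe_mem_image_Icc_iff ht, Set.mem_Ioc,
      Set.mem_Icc]
    constructor
    · rintro ⟨h1, h2, h3⟩
      refine ⟨?_, by linarith⟩
      by_contra! hu
      have : Int.fract u = u + 1 := Int.fract_eq_iff.2 ⟨by linarith, by linarith, -1, by simp⟩
      linarith
    · rintro ⟨h1, h2⟩
      rw [Int.fract_eq_self.2 ⟨h1, by linarith⟩]
      exact ⟨h2, by linarith, by linarith⟩
  rw [Measure.real, AddCircle.add_projection_respects_measure 1 (t - 1) hclosed.measurableSet]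
  erw [hset]
  simp [ht0]

theorem signif_eq_rpow_fract {x : ℝ} (hx : 0 < x) :
    signif x = (10 : ℝ) ^ Int.fract (Real.logb 10 x) := by
  rw [signif, Int.fract, Real.rpow_sub (by norm_num), Real.rpow_logb (by norm_num) (by norm_num) hx,
    Real.rpow_intCast]

theorem signif_le_iff {x s : ℝ} (hx : 0 < x) (hs : 0 < s) :
    signif x ≤ s ↔ Int.fract (Real.logb 10 x) ≤ Real.logb 10 s := by
  rw [signif_eq_rpow_fract hx, Real.le_logb_iff_rpow_le (by norm_num) hs]

theorem tendsto_sum_binomial_mul_fourier (c : ℕ → ℝ) {y : ℝ} (hy : Irrational y) {n : ℤ}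
    (hn : n ≠ 0) :
    Tendsto (fun N : ℕ => ∑ k ∈ Finset.range (N + 1),
      ((1 / 2 ^ N * (N.choose k : ℝ) : ℝ) : ℂ) * fourier n ((c N + k * y : ℝ) : UnitAddCircle))
      atTop (𝓝 0) := by
  have hnorm (x : UnitAddCircle) : ‖(fourier n x : ℂ)‖ = 1 := by
    rw [fourier_apply, Circle.norm_coe]
  set z : ℂ := fourier n (y : UnitAddCircle) with hz
  have hz1 : ‖z‖ = 1 := hnorm _
  have hzne : z ≠ 1 := by
    rw [hz, fourier_coe_apply, Ne, Complex.exp_eq_one_iff]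
    rintro ⟨m, hm⟩
    have hn' : (n : ℝ) ≠ 0 := Int.cast_ne_zero.2 hn
    have hm' : (n : ℂ) * y = m := by
      refine mul_left_cancel₀ Complex.two_pi_I_ne_zero ?_
      rw [mul_comm _ (m : ℂ), ← hm]
      push_cast
      ring
    have hm'' : (n : ℝ) * y = m := by exact_mod_cast hm'
    exact hy ⟨m / n, by push_cast; field_simp; linarith⟩
  have hlt : ‖(1 + z) / 2‖ < 1 := by
    have hle : ‖1 + z‖ ≤ ‖(1 : ℂ)‖ + ‖z‖ := norm_add_le _ _
    have hne : ‖1 + z‖ ≠ ‖(1 : ℂ)‖ + ‖z‖ := fun h =>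
      hzne (eq_of_norm_eq_of_norm_add_eq (by rw [hz1, norm_one]) h).symm
    have hlt2 := hle.lt_of_ne hne
    rw [hz1, norm_one] at hlt2
    rw [norm_div, Complex.norm_two]
    linarith
  have hsum (N : ℕ) : ∑ k ∈ Finset.range (N + 1),
      ((1 / 2 ^ N * (N.choose k : ℝ) : ℝ) : ℂ) * fourier n ((c N + k * y : ℝ) : UnitAddCircle) =
      fourier n (c N : UnitAddCircle) * ((1 + z) / 2) ^ N := by
    have hterm (k : ℕ) : fourier n ((c N + k * y : ℝ) : UnitAddCircle) =
        fourier n (c N : UnitAddCircle) * z ^ k := by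
      simp only [hz, fourier_coe_apply, ← Complex.exp_nat_mul, ← Complex.exp_add]
      congr 1
      push_cast
      ring
    rw [div_pow, add_comm 1 z, add_pow, Finset.sum_div, Finset.mul_sum]
    refine Finset.sum_congr rfl fun k _ => ?_
    rw [hterm]
    push_cast
    ring
  simp_rw [hsum]
  rw [tendsto_zero_iff_norm_tendsto_zero]
  simp_rw [norm_mul, hnorm, one_mul, norm_pow]
  exact tendsto_pow_atTop_nhds_zero_of_lt_one (norm_nonneg _) hlt

/-- **Fixed Proportion Decomposition, irrational case**: if `y = log₁₀((1-p)/p)` is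
irrational, the stick lengths converge in distribution to Benford's Law. -/
theorem fixedProportion_irrational_benford
    (L : ℝ) (hL : 0 < L) (p : ℝ) (hp : p ∈ Set.Ioo (0 : ℝ) 1)
    (hy : Irrational (Real.logb 10 ((1 - p) / p)))
    (s : ℝ) (hs : s ∈ Set.Ico (1 : ℝ) 10) :
    Tendsto (fun N : ℕ => fixedP L p N s) atTop (nhds (Real.logb 10 s)) := by
  obtain ⟨hp0, hp1⟩ := hp
  have hq0 : 0 < 1 - p := by linarith
  have hs0 : 0 < s := by linarith [hs.1]
  have ht0 : 0 ≤ Real.logb 10 s := Real.logb_nonneg (by norm_num) hs.1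
  have ht1 : Real.logb 10 s < 1 := by
    rw [Real.logb_lt_iff_lt_rpow (by norm_num) hs0, Real.rpow_one]
    exact hs.2
  have hlim : Tendsto (fun N : ℕ => ∑ k ∈ Finset.range (N + 1), (1 / 2 ^ N * (N.choose k : ℝ)) *
      ((↑) '' Set.Icc 0 (Real.logb 10 s) : Set UnitAddCircle).indicator 1
        ((Real.logb 10 L + N * Real.logb 10 p +
          k * Real.logb 10 ((1 - p) / p) : ℝ) : UnitAddCircle)) atTop
      (nhds (volume.real ((↑) '' Set.Icc 0 (Real.logb 10 s) : Set UnitAddCircle))) := by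
    refine UnitAddCircle.tendsto_sum_indicator_of_fourier (κ := fun N => Finset.range (N + 1))
      (w := fun N k => 1 / 2 ^ N * (N.choose k : ℝ)) (fun N k _ => by positivity) (fun N => ?_)
      (fun n hn => ?_) ?_ (UnitAddCircle.volume_frontier_image_Icc _ _)
    · rw [← Finset.mul_sum, ← Nat.cast_sum, Nat.sum_range_choose]
      simp
    · exact tendsto_sum_binomial_mul_fourier
        (fun N => Real.logb 10 L + N * Real.logb 10 p) hy hn
    · exact (isCompact_Icc.image (AddCircle.continuous_mk' 1)).isClosed.measurableSet
  rw [UnitAddCircle.volume_real_image_Icc ht0 ht1] at hlim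
  refine hlim.congr fun N => Finset.sum_congr rfl fun k hk => ?_
  have hkN : k ≤ N := Nat.lt_succ_iff.1 (Finset.mem_range.1 hk)
  have hlog : Real.logb 10 (L * p ^ (N - k) * (1 - p) ^ k) =
      Real.logb 10 L + N * Real.logb 10 p + k * Real.logb 10 ((1 - p) / p) := by
    rw [Real.logb_mul (by positivity) (by positivity), Real.logb_mul (by positivity) (by positivity),
      Real.logb_div (by positivity) (by positivity), Real.logb_pow, Real.logb_pow,
      Nat.cast_sub hkN]
    ring
  congr 1
  classical
  rw [phi, ← hlog, Set.indicator_apply]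
  simp only [UnitAddCircle.coe_mem_image_Icc_iff ht1,
    signif_le_iff (show 0 < L * p ^ (N - k) * (1 - p) ^ k by positivity) hs0, Pi.one_apply]
end

section
/- Fixed Proportion Decomposition, rational case: Fix L > 0 and p ∈ (0,1), and suppose y = log₁₀((1−p)/p) = r/q is rational, with r ∈ ℤ, q a positive integer, and gcd(r,q) = 1. Define P_N(s) = Σ_{k=0}^{N} 2^{−N} · C(N,k) · φ_s(L·p^{N−k}·(1−p)^k). Then: (a) for every N ≥ 1 and every s ∈ [1,10) there exists an integer a with |P_N(s) − a/q| ≤ (q−1)·(cos(π/q))^N; and (b) it is not the case that P_N(s) → log₁₀ s for every s ∈ [1,10), i.e., the process does not converge to Benford's Law. -/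
open Filter

lemma signif_mul_zpow {x : ℝ} (hx : 0 < x) (r : ℤ) : signif (x * (10 : ℝ) ^ r) = signif x := by
  have h10 : (10 : ℝ) ^ r ≠ 0 := by positivity
  have hlog : Real.logb 10 (x * (10 : ℝ) ^ r) = Real.logb 10 x + (r : ℤ) := by
    rw [Real.logb_mul hx.ne' h10, ← Real.rpow_intCast,
      Real.logb_rpow (by norm_num) (by norm_num)]
  unfold signif
  rw [hlog, Int.floor_add_intCast, zpow_add₀ (by norm_num), mul_div_mul_right _ _ h10]

lemma norm_one_add_exp_two_mul_I (x : ℝ) :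
    ‖1 + Complex.exp (2 * x * Complex.I)‖ = 2 * |Real.cos x| := by
  have h : 1 + Complex.exp (2 * x * Complex.I)
      = Complex.exp (x * Complex.I) * (2 * (Real.cos x : ℂ)) := by
    rw [Complex.ofReal_cos, Complex.two_cos, mul_add, ← Complex.exp_add, ← Complex.exp_add]
    ring_nf
    simp [add_comm]
  rw [h, norm_mul, Complex.norm_exp_ofReal_mul_I, one_mul, norm_mul, Complex.norm_real]
  simp

lemma abs_cos_nat_mul_pi_div_le {q m : ℕ} (hm : 0 < m) (hmq : m < q) :
    |Real.cos (Real.pi * m / q)| ≤ Real.cos (Real.pi / q) := by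
  have hq : (0 : ℝ) < q := by exact_mod_cast hm.trans hmq
  have hm1 : (1 : ℝ) ≤ m := by exact_mod_cast hm
  have hmq1 : (m : ℝ) + 1 ≤ q := by exact_mod_cast hmq
  have hpi := Real.pi_pos
  have h1 : Real.pi / q ≤ Real.pi * m / q := by
    gcongr
    nlinarith
  have h2 : Real.pi * m / q + Real.pi / q ≤ Real.pi := by
    rw [← add_div, div_le_iff₀ hq]
    nlinarith
  have h0 : 0 < Real.pi / q := by positivity
  rw [abs_le']
  constructor
  · exact Real.cos_le_cos_of_nonneg_of_le_pi h0.le (by linarith) h1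
  · rw [← Real.cos_pi_sub]
    exact Real.cos_le_cos_of_nonneg_of_le_pi h0.le (by linarith) (by linarith)

lemma IsPrimitiveRoot.sum_pow_pow_eq_ite {ζ : ℂ} {q : ℕ} (hζ : IsPrimitiveRoot ζ q) (n : ℕ) :
    ∑ m ∈ Finset.range q, (ζ ^ n) ^ m = if q ∣ n then (q : ℂ) else 0 := by
  split_ifs with h
  · simp [(hζ.pow_eq_one_iff_dvd n).2 h]
  · have h1 : ζ ^ n ≠ 1 := fun e => h ((hζ.pow_eq_one_iff_dvd n).1 e)
    rw [geom_sum_eq h1, ← pow_mul, mul_comm, pow_mul, hζ.pow_eq_one]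
    simp

/-- Discrete Fourier expansion of the binomial average of a periodic function. -/
lemma sum_choose_mul_periodic_eq {ζ : ℂ} {q : ℕ} (hq : 0 < q) (hζ : IsPrimitiveRoot ζ q)
    {g : ℕ → ℝ} (hg : Function.Periodic g q) (N : ℕ) :
    ((∑ k ∈ Finset.range (N + 1), (1 / 2 ^ N : ℝ) * (N.choose k : ℝ) * g k : ℝ) : ℂ)
      = (1 / q : ℂ) * ∑ m ∈ Finset.range q, ∑ j ∈ Finset.range q,
          (g j : ℂ) * (ζ ^ (q - j)) ^ m * ((1 + ζ ^ m) / 2) ^ N := by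
  have hq0 : (q : ℂ) ≠ 0 := by exact_mod_cast hq.ne'
  have hexp (k : ℕ) : (g k : ℂ) = (1 / q : ℂ) * ∑ m ∈ Finset.range q, ∑ j ∈ Finset.range q,
      (g j : ℂ) * (ζ ^ (q - j)) ^ m * (ζ ^ m) ^ k := by
    rw [Finset.sum_comm]
    have hj : ∀ j ∈ Finset.range q, ∑ m ∈ Finset.range q,
        (g j : ℂ) * (ζ ^ (q - j)) ^ m * (ζ ^ m) ^ k
          = if k % q = j then (g j : ℂ) * q else 0 := by
      intro j hj
      rw [Finset.mem_range] at hj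
      have hdvd : q ∣ q - j + k ↔ k % q = j := by
        have hz : q ∣ q - j + k ↔ k ≡ j [MOD q] := by
          rw [Nat.modEq_iff_dvd, ← Int.natCast_dvd_natCast, ← dvd_neg (b := (j : ℤ) - k)]
          push_cast [hj.le]
          rw [show -((j : ℤ) - k) = (q - j + k) - q by ring]
          exact (dvd_sub_self_right).symm
        rw [hz, Nat.ModEq, Nat.mod_eq_of_lt hj]
      have hsum := hζ.sum_pow_pow_eq_ite (q - j + k)
      simp only [hdvd] at hsum
      calc _ = (g j : ℂ) * ∑ m ∈ Finset.range q, (ζ ^ (q - j + k)) ^ m := by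
            rw [Finset.mul_sum]
            refine Finset.sum_congr rfl fun m _ => ?_
            ring
        _ = _ := by rw [hsum, mul_ite, mul_zero]
    rw [Finset.sum_congr rfl hj, Finset.sum_ite_eq, if_pos (Finset.mem_range.2 (k.mod_lt hq)),
      hg.map_mod_nat]
    field_simp
  have hbin (m : ℕ) : ((1 + ζ ^ m) / 2) ^ N
      = ∑ k ∈ Finset.range (N + 1), (1 / 2 ^ N : ℂ) * (N.choose k : ℂ) * (ζ ^ m) ^ k := by
    rw [div_pow, add_comm, add_pow, Finset.sum_div]
    refine Finset.sum_congr rfl fun k _ => ?_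
    rw [one_pow]
    ring
  push_cast
  simp_rw [hbin, Finset.mul_sum]
  rw [Finset.sum_congr rfl fun k _ => by rw [hexp k]]
  simp_rw [Finset.mul_sum]
  rw [Finset.sum_comm]
  refine Finset.sum_congr rfl fun m _ => ?_
  rw [Finset.sum_comm]
  refine Finset.sum_congr rfl fun j _ => Finset.sum_congr rfl fun k _ => ?_
  ring

/-- The binomial average of a periodic function bounded by `1` is exponentially close to its
mean over a period. -/
lemma abs_sum_choose_mul_periodic_sub_le {q : ℕ} (hq : 0 < q) {g : ℕ → ℝ}
    (hg : Function.Periodic g q) (hg1 : ∀ k, |g k| ≤ 1) (N : ℕ) :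
    |∑ k ∈ Finset.range (N + 1), (1 / 2 ^ N : ℝ) * (N.choose k : ℝ) * g k
        - (∑ j ∈ Finset.range q, g j) / q|
      ≤ ((q : ℝ) - 1) * Real.cos (Real.pi / q) ^ N := by
  have hqR : (0 : ℝ) < q := by exact_mod_cast hq
  have hζ := Complex.isPrimitiveRoot_exp q hq.ne'
  set ζ : ℂ := Complex.exp (2 * Real.pi * Complex.I / q) with hζdef
  have hζ1 : ‖ζ‖ = 1 := hζ.norm'_eq_one hq.ne'
  have hfac : ∀ m ∈ (Finset.range q).erase 0,
      ‖((1 + ζ ^ m) / 2) ^ N‖ ≤ Real.cos (Real.pi / q) ^ N := by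
    intro m hm
    rw [Finset.mem_erase, Finset.mem_range] at hm
    rw [norm_pow]
    refine pow_le_pow_left₀ (norm_nonneg _) ?_ N
    have hpow : ζ ^ m = Complex.exp (2 * (Real.pi * m / q : ℝ) * Complex.I) := by
      rw [hζdef, ← Complex.exp_nat_mul]
      congr 1
      push_cast
      ring
    rw [norm_div, hpow, norm_one_add_exp_two_mul_I]
    have := abs_cos_nat_mul_pi_div_le (Nat.pos_of_ne_zero hm.1) hm.2
    simpa using this
  have hsub : ((∑ k ∈ Finset.range (N + 1), (1 / 2 ^ N : ℝ) * (N.choose k : ℝ) * g k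
        - (∑ j ∈ Finset.range q, g j) / q : ℝ) : ℂ)
      = (1 / q : ℂ) * ∑ m ∈ (Finset.range q).erase 0, ∑ j ∈ Finset.range q,
          (g j : ℂ) * (ζ ^ (q - j)) ^ m * ((1 + ζ ^ m) / 2) ^ N := by
    rw [Complex.ofReal_sub, sum_choose_mul_periodic_eq hq hζ hg N,
      ← Finset.add_sum_erase _ _ (Finset.mem_range.2 hq)]
    have h2 : ((1 + 1) / 2 : ℂ) = 1 := by norm_num
    simp only [pow_zero, mul_one, h2, one_pow]
    push_cast
    ring
  rw [← Real.norm_eq_abs, ← Complex.norm_real, hsub,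
    norm_mul]
  have hbound : ‖∑ m ∈ (Finset.range q).erase 0, ∑ j ∈ Finset.range q,
        (g j : ℂ) * (ζ ^ (q - j)) ^ m * ((1 + ζ ^ m) / 2) ^ N‖
      ≤ ∑ _m ∈ (Finset.range q).erase 0, ∑ _j ∈ Finset.range q,
        Real.cos (Real.pi / q) ^ N := by
    refine norm_sum_le_of_le _ fun m hm => norm_sum_le_of_le _ fun j _ => ?_
    rw [norm_mul, norm_mul, norm_pow, norm_pow, hζ1, one_pow, one_pow, mul_one,
      Complex.norm_real, Real.norm_eq_abs]
    exact (mul_le_of_le_one_left (norm_nonneg _) (hg1 j)).trans (hfac m hm)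
  rw [Finset.sum_const, Finset.sum_const, Finset.card_erase_of_mem (Finset.mem_range.2 hq),
    Finset.card_range, nsmul_eq_mul, nsmul_eq_mul, Nat.cast_pred hq] at hbound
  calc _ ≤ ‖(1 / q : ℂ)‖ * (((q : ℝ) - 1) * (q * Real.cos (Real.pi / q) ^ N)) := by gcongr
    _ = _ := by
      simp only [norm_div, norm_one, Complex.norm_natCast]
      field_simp

lemma tendsto_sub_one_mul_cos_pi_div_pow {q : ℕ} (hq : 0 < q) :
    Tendsto (fun N : ℕ => ((q : ℝ) - 1) * Real.cos (Real.pi / q) ^ N) atTop (nhds 0) := by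
  rcases Nat.lt_or_eq_of_le (Nat.succ_le_of_lt hq) with h | h
  · have hq2 : (2 : ℝ) ≤ q := by exact_mod_cast h
    have hpi := Real.pi_pos
    have h0 : 0 < Real.pi / q := by positivity
    have h1 : Real.pi / q ≤ Real.pi / 2 := by gcongr
    have hcos : Real.cos (Real.pi / q) < 1 := by
      rw [← Real.cos_zero]
      exact Real.cos_lt_cos_of_nonneg_of_le_pi le_rfl (by linarith) h0
    have hcos0 : 0 ≤ Real.cos (Real.pi / q) :=
      Real.cos_nonneg_of_mem_Icc ⟨by linarith, h1⟩
    simpa using (tendsto_pow_atTop_nhds_zero_of_lt_one hcos0 hcos).const_mul ((q : ℝ) - 1)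
  · simp [← h]

lemma half_le_abs_half_sub_intCast (a : ℤ) : (1 / 2 : ℝ) ≤ |1 / 2 - (a : ℝ)| := by
  rw [le_abs]
  rcases le_or_gt a 0 with h | h
  · left
    have : (a : ℝ) ≤ 0 := by exact_mod_cast h
    linarith
  · right
    have : (1 : ℝ) ≤ a := by exact_mod_cast h
    linarith

lemma exists_int_abs_fixedP_sub_le {L : ℝ} (hL : 0 < L) {p : ℝ} (hp : p ∈ Set.Ioo (0 : ℝ) 1)
    {r : ℤ} {q : ℕ} (hq : 0 < q) (hy : Real.logb 10 ((1 - p) / p) = (r : ℝ) / (q : ℝ))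
    (N : ℕ) (s : ℝ) :
    ∃ a : ℤ, |fixedP L p N s - (a : ℝ) / (q : ℝ)| ≤
      ((q : ℝ) - 1) * (Real.cos (Real.pi / q)) ^ N := by
  obtain ⟨hp0, hp1⟩ := hp
  have hq0 : (q : ℝ) ≠ 0 := by exact_mod_cast hq.ne'
  have hρ : 0 < (1 - p) / p := div_pos (by linarith) hp0
  have hρq : ((1 - p) / p) ^ q = (10 : ℝ) ^ r := by
    rw [← Real.rpow_logb (by norm_num : (0 : ℝ) < 10) (by norm_num) hρ, hy,
      ← Real.rpow_natCast, ← Real.rpow_mul (by norm_num), div_mul_cancel₀ _ hq0,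
      Real.rpow_intCast]
  set ρ := (1 - p) / p with hρdef
  let g : ℕ → ℝ := fun k => phi s (L * p ^ N * ρ ^ k)
  have hg : Function.Periodic g q := by
    intro k
    simp only [g, phi]
    rw [pow_add, hρq, ← mul_assoc, signif_mul_zpow (by positivity)]
  have hg1 (k : ℕ) : |g k| ≤ 1 := by
    simp only [g, phi]
    split_ifs <;> simp
  have hfix : fixedP L p N s
      = ∑ k ∈ Finset.range (N + 1), (1 / 2 ^ N : ℝ) * (N.choose k : ℝ) * g k := by
    refine Finset.sum_congr rfl fun k hk => ?_
    have hk' : k ≤ N := Nat.lt_succ_iff.1 (Finset.mem_range.1 hk)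
    have hx : L * p ^ (N - k) * (1 - p) ^ k = L * p ^ N * ρ ^ k := by
      obtain ⟨d, rfl⟩ := Nat.exists_eq_add_of_le hk'
      rw [hρdef, Nat.add_sub_cancel_left, div_pow, pow_add]
      field_simp
    rw [hx]
  refine ⟨∑ j ∈ Finset.range q, if signif (L * p ^ N * ρ ^ j) ≤ s then 1 else 0, ?_⟩
  have h := abs_sum_choose_mul_periodic_sub_le hq hg hg1 N
  rw [← hfix] at h
  push_cast
  exact h

/-- **Fixed Proportion Decomposition, rational case**: if `y = log₁₀((1-p)/p) = r/q` in
lowest terms then (a) `P_N(s)` is within `(q-1)(cos(π/q))^N` of a rational number with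
denominator `q`, and (b) the process does not converge to Benford's Law. -/
theorem fixedProportion_rational_not_benford
    (L : ℝ) (hL : 0 < L) (p : ℝ) (hp : p ∈ Set.Ioo (0 : ℝ) 1)
    (r : ℤ) (q : ℕ) (hq : 0 < q) (hgcd : Int.gcd r (q : ℤ) = 1)
    (hy : Real.logb 10 ((1 - p) / p) = (r : ℝ) / (q : ℝ)) :
    (∀ N : ℕ, 1 ≤ N → ∀ s ∈ Set.Ico (1 : ℝ) 10, ∃ a : ℤ,
        |fixedP L p N s - (a : ℝ) / (q : ℝ)| ≤
          ((q : ℝ) - 1) * (Real.cos (Real.pi / q)) ^ N) ∧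
      ¬ ∀ s ∈ Set.Ico (1 : ℝ) 10,
          Tendsto (fun N : ℕ => fixedP L p N s) atTop (nhds (Real.logb 10 s)) := by
  refine ⟨fun N _ s _ => exists_int_abs_fixedP_sub_le hL hp hq hy N s, fun hlim => ?_⟩
  have hqR : (1 : ℝ) ≤ q := by exact_mod_cast hq
  have hexp : 1 / (2 * (q : ℝ)) < 1 := by
    rw [div_lt_one (by positivity)]
    linarith
  have hs : (10 : ℝ) ^ (1 / (2 * (q : ℝ))) ∈ Set.Ico (1 : ℝ) 10 := by
    refine ⟨Real.one_le_rpow (by norm_num) (by positivity), ?_⟩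
    calc (10 : ℝ) ^ (1 / (2 * (q : ℝ))) < (10 : ℝ) ^ (1 : ℝ) :=
          Real.rpow_lt_rpow_of_exponent_lt (by norm_num) hexp
      _ = 10 := Real.rpow_one 10
  have hP := hlim _ hs
  rw [Real.logb_rpow (by norm_num) (by norm_num)] at hP
  have hsum := (hP.sub_const (1 / (2 * (q : ℝ)))).abs.add (tendsto_sub_one_mul_cos_pi_div_pow hq)
  rw [sub_self, abs_zero, add_zero] at hsum
  have hle : 1 / (2 * (q : ℝ)) ≤ 0 := by
    refine ge_of_tendsto hsum (Eventually.of_forall fun N => ?_)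
    obtain ⟨a, ha⟩ := exists_int_abs_fixedP_sub_le hL hp hq hy N
      ((10 : ℝ) ^ (1 / (2 * (q : ℝ))))
    have hgap : 1 / (2 * (q : ℝ)) ≤ |1 / (2 * (q : ℝ)) - a / q| := by
      have heq : 1 / (2 * (q : ℝ)) - a / q = (1 / 2 - a) / q := by
        field_simp
      rw [heq, abs_div, abs_of_pos (by linarith : (0 : ℝ) < q), ← div_div]
      gcongr
      exact half_le_abs_half_sub_intCast a
    have htri := abs_sub_le (1 / (2 * (q : ℝ)))
      (fixedP L p N ((10 : ℝ) ^ (1 / (2 * (q : ℝ))))) (a / q)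
    rw [abs_sub_comm (1 / (2 * (q : ℝ))) (fixedP _ _ _ _)] at htri
    linarith
  have hpos : 0 < 1 / (2 * (q : ℝ)) := by positivity
  linarith
end

section
/- The uniform density satisfies the Mellin condition: Let f be the indicator function of (0,1) (the uniform probability density). Then for every ℓ ∈ ℤ, M_f(1 − 2πiℓ/log 10) = (1 − 2πiℓ/log 10)^{−1}, and consequently lim_{N→∞} Σ_{ℓ∈ℤ, ℓ≠0} (1 − 2πiℓ/log 10)^{−N} = 0 (the sum converging absolutely for each N ≥ 2). -/
open Filter

/-- Mellin transform `M_h(w) = ∫₀^∞ h(x) x^{w-1} dx`. -/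
noncomputable def mellinT (h : ℝ → ℝ) (w : ℂ) : ℂ :=
  ∫ x in Set.Ioi (0 : ℝ), (h x : ℂ) * (x : ℂ) ^ (w - 1)

/-- The argument `1 - 2πiℓ/log 10`. -/
noncomputable def mellinArg (ℓ : ℤ) : ℂ :=
  1 - 2 * (Real.pi : ℂ) * Complex.I * (ℓ : ℂ) / (Real.log 10 : ℂ)

theorem mellinArg_re (ℓ : ℤ) : (mellinArg ℓ).re = 1 := by
  have h : mellinArg ℓ =
      1 - ((2 * Real.pi * ℓ / Real.log 10 : ℝ) : ℂ) * Complex.I := by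
    unfold mellinArg
    push_cast
    ring
  simp only [h, Complex.sub_re, Complex.one_re, Complex.re_ofReal_mul, Complex.I_re]
  ring

theorem mellinArg_im (ℓ : ℤ) : (mellinArg ℓ).im = -(2 * Real.pi * ℓ / Real.log 10) := by
  have h : mellinArg ℓ =
      1 - ((2 * Real.pi * ℓ / Real.log 10 : ℝ) : ℂ) * Complex.I := by
    unfold mellinArg
    push_cast
    ring
  simp only [h, Complex.sub_im, Complex.one_im, Complex.im_ofReal_mul, Complex.I_im]
  ring

theorem log_ten_le_two_pi : Real.log 10 ≤ 2 * Real.pi := by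
  rw [Real.log_le_iff_le_exp (by norm_num)]
  have h := Real.quadratic_le_exp_of_nonneg (x := 2 * Real.pi) (by positivity)
  nlinarith [Real.pi_gt_three]

theorem sq_le_mellinArg_im_sq (ℓ : ℤ) : (ℓ : ℝ) ^ 2 ≤ (mellinArg ℓ).im ^ 2 := by
  have hlog : 0 < Real.log 10 := Real.log_pos (by norm_num)
  have h : 1 ≤ 2 * Real.pi / Real.log 10 := (one_le_div hlog).2 log_ten_le_two_pi
  calc (ℓ : ℝ) ^ 2 = 1 * (ℓ : ℝ) ^ 2 := (one_mul _).symm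
    _ ≤ (2 * Real.pi / Real.log 10) ^ 2 * (ℓ : ℝ) ^ 2 := by
      gcongr
      exact one_le_pow₀ h
    _ = (mellinArg ℓ).im ^ 2 := by
      rw [mellinArg_im]
      ring

theorem one_add_sq_le_norm_mellinArg_sq (ℓ : ℤ) : 1 + (ℓ : ℝ) ^ 2 ≤ ‖mellinArg ℓ‖ ^ 2 := by
  rw [Complex.sq_norm, Complex.normSq_apply, mellinArg_re]
  nlinarith [sq_le_mellinArg_im_sq ℓ]

theorem norm_inv_mellinArg_le_one (ℓ : ℤ) : ‖(mellinArg ℓ)⁻¹‖ ≤ 1 := by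
  rw [norm_inv]
  apply inv_le_one_of_one_le₀
  nlinarith [one_add_sq_le_norm_mellinArg_sq ℓ, sq_nonneg (ℓ : ℝ), norm_nonneg (mellinArg ℓ)]

theorem norm_inv_mellinArg_lt_one {ℓ : ℤ} (hℓ : ℓ ≠ 0) : ‖(mellinArg ℓ)⁻¹‖ < 1 := by
  rw [norm_inv]
  apply inv_lt_one_of_one_lt₀
  have h : 0 < (ℓ : ℝ) ^ 2 := by positivity
  nlinarith [one_add_sq_le_norm_mellinArg_sq ℓ, norm_nonneg (mellinArg ℓ)]

theorem norm_inv_mellinArg_pow_le {ℓ : ℤ} (hℓ : ℓ ≠ 0) {N : ℕ} (hN : 2 ≤ N) :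
    ‖((mellinArg ℓ)⁻¹) ^ N‖ ≤ 1 / (ℓ : ℝ) ^ 2 := by
  rw [norm_pow]
  refine (pow_le_pow_of_le_one (norm_nonneg _) (norm_inv_mellinArg_le_one ℓ) hN).trans ?_
  rw [norm_inv, inv_pow, ← one_div]
  have h : 0 < (ℓ : ℝ) ^ 2 := by positivity
  exact one_div_le_one_div_of_le h (by linarith [one_add_sq_le_norm_mellinArg_sq ℓ])

theorem summable_one_div_sq_ne_zero :
    Summable fun ℓ : {l : ℤ // l ≠ 0} => 1 / ((ℓ : ℤ) : ℝ) ^ 2 :=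
  (Real.summable_one_div_int_pow.2 one_lt_two).comp_injective Subtype.val_injective

theorem mellinT_indicator_Ioo {s : ℂ} (hs : 0 < s.re) :
    mellinT (Set.indicator (Set.Ioo (0 : ℝ) 1) fun _ => (1 : ℝ)) s = s⁻¹ := by
  rw [← one_div, ← (hasMellin_one_Ioc hs).2]
  refine MeasureTheory.integral_congr_ae (MeasureTheory.ae_restrict_of_ae ?_)
  filter_upwards [MeasureTheory.Ioo_ae_eq_Ioc (μ := MeasureTheory.volume) (a := (0 : ℝ)) (b := 1)]
    with x hx
  have hmem : x ∈ Set.Ioo (0 : ℝ) 1 ↔ x ∈ Set.Ioc (0 : ℝ) 1 := iff_of_eq hx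
  by_cases h : x ∈ Set.Ioc (0 : ℝ) 1
  · simp [Set.indicator_of_mem h, Set.indicator_of_mem (hmem.2 h)]
  · simp [Set.indicator_of_notMem h, Set.indicator_of_notMem (mt hmem.1 h)]

/-- **The uniform density satisfies the Mellin condition**: for the indicator `f` of `(0,1)`,
`M_f(1 - 2πiℓ/log 10) = (1 - 2πiℓ/log 10)⁻¹` for every `ℓ ∈ ℤ`, and consequently
`Σ_{ℓ≠0} (1 - 2πiℓ/log 10)^{-N} → 0` as `N → ∞`, the sum converging absolutely for `N ≥ 2`. -/
theorem uniform_density_mellin_condition :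
    (∀ ℓ : ℤ,
        mellinT (Set.indicator (Set.Ioo (0 : ℝ) 1) fun _ => (1 : ℝ)) (mellinArg ℓ)
          = (mellinArg ℓ)⁻¹) ∧
      Tendsto (fun N : ℕ => ∑' ℓ : {l : ℤ // l ≠ 0}, ((mellinArg ℓ)⁻¹) ^ N)
        atTop (nhds 0) ∧
      ∀ N : ℕ, 2 ≤ N →
        Summable fun ℓ : {l : ℤ // l ≠ 0} => ‖((mellinArg ℓ)⁻¹) ^ N‖ := by
  refine ⟨fun ℓ => mellinT_indicator_Ioo (by simp [mellinArg_re]), ?_, fun N hN => ?_⟩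
  · rw [← tsum_zero (α := ℂ) (β := {l : ℤ // l ≠ 0})]
    refine tendsto_tsum_of_dominated_convergence summable_one_div_sq_ne_zero (fun ℓ => ?_) ?_
    · exact tendsto_pow_atTop_nhds_zero_of_norm_lt_one (norm_inv_mellinArg_lt_one ℓ.2)
    · filter_upwards [eventually_ge_atTop 2] with N hN ℓ
      exact norm_inv_mellinArg_pow_le ℓ.2 hN
  · exact summable_one_div_sq_ne_zero.of_nonneg_of_le (fun _ => norm_nonneg _)
      fun ℓ => norm_inv_mellinArg_pow_le ℓ.2 hN
end
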